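/- Let 𝒜 = {H₁ ≺ H₂ ≺ ⋯ ≺ H_m} be a hyperplane arrangement in ℝⁿ. Then for each k = 0, 1, …, m, |ℛ(𝒜)| = Σ over all ℬ ∈ NBC(𝒜) with ℬ ⊆ 𝒜_k of |ℛ(𝒜_kᶜ/ℬ)|, and this common value also equals |NBC(𝒜)|. -/

import Mathlib

open Set

/-- An affine hyperplane in `ℝⁿ`, given by a nonzero normal vector `a` and
a constant `b`: the hyperplane is `{x : ⟨a, x⟩ = b}`. -/
structure Hyp (n : ℕ) where
  a : Fin n → ℝ
  b : ℝ
  ha : a ≠ 0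

/-- The hyperplane itself, as a subset of `ℝⁿ`. -/
def Hyp.carrier {n : ℕ} (H : Hyp n) : Set (Fin n → ℝ) := {x | ∑ i, H.a i * x i = H.b}

/-- The positive open side of a hyperplane. -/
def Hyp.pos {n : ℕ} (H : Hyp n) : Set (Fin n → ℝ) := {x | H.b < ∑ i, H.a i * x i}

/-- The negative open side of a hyperplane. -/
def Hyp.neg {n : ℕ} (H : Hyp n) : Set (Fin n → ℝ) := {x | ∑ i, H.a i * x i < H.b}

/-- The intersection `⋂ℬ` of the hyperplanes indexed by `S` (`ℝⁿ` if `S = ∅`). -/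
def interA {n m : ℕ} (H : Fin m → Hyp n) (S : Finset (Fin m)) : Set (Fin n → ℝ) :=
  ⋂ i ∈ S, (H i).carrier

/-- The dimension of an affine subset of `ℝⁿ` (the rank of its vector span). -/
noncomputable def adim {n : ℕ} (s : Set (Fin n → ℝ)) : ℕ :=
  Module.finrank ℝ (vectorSpan ℝ s)

/-- The defining property of an affine circuit: `⋂ℬ ≠ ∅` and `dim(⋂ℬ) + |ℬ| = n + 1`. -/
def CircuitProp {n m : ℕ} (H : Fin m → Hyp n) (S : Finset (Fin m)) : Prop :=
  (interA H S).Nonempty ∧ adim (interA H S) + S.card = n + 1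

/-- An affine circuit: an inclusion-minimal `S` with `⋂S ≠ ∅` and `dim(⋂S) + |S| = n + 1`. -/
def IsAffCircuit {n m : ℕ} (H : Fin m → Hyp n) (S : Finset (Fin m)) : Prop :=
  CircuitProp H S ∧ ∀ T ⊂ S, ¬ CircuitProp H T

/-- An affine NBC subset: `⋂S ≠ ∅` and `S` contains no affine broken circuit, i.e. no
affine circuit with its maximal element deleted. -/
def IsAffNBC {n m : ℕ} (H : Fin m → Hyp n) (S : Finset (Fin m)) : Prop :=
  (interA H S).Nonempty ∧
    ∀ T : Finset (Fin m), IsAffCircuit H T → ∀ h : T.Nonempty, ¬ T.erase (T.max' h) ⊆ S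

/-- `Δ` is a region of the open set `U`, i.e. a connected component of `U`. -/
def IsRegionIn {n : ℕ} (U Δ : Set (Fin n → ℝ)) : Prop :=
  ∃ x ∈ U, Δ = connectedComponentIn U x

/-- The set of regions of the arrangement `H`: connected components of the complement
of the union of the hyperplanes. -/
def regions {n m : ℕ} (H : Fin m → Hyp n) : Set (Set (Fin n → ℝ)) :=
  {Δ | IsRegionIn (Set.univ \ ⋃ i, (H i).carrier) Δ}

/-- `𝒜_k = {H₁, …, H_k}`, as a set of indices. -/
def Ak (m k : ℕ) : Finset (Fin m) := Finset.filter (fun i => (i : ℕ) < k) Finset.univ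

/-- The underlying open set of the restriction `𝒜_kᶜ/ℬ`: the affine subspace `⋂ℬ`
minus the traces `(⋂ℬ) ∩ H` of those hyperplanes `H ∈ 𝒜_kᶜ` with
`∅ ≠ (⋂ℬ) ∩ H ⊊ ⋂ℬ`; its connected components are the regions of `𝒜_kᶜ/ℬ`. -/
def restCompl {n m : ℕ} (H : Fin m → Hyp n) (k : ℕ) (S : Finset (Fin m)) :
    Set (Fin n → ℝ) :=
  interA H S \
    ⋃ i ∈ {i : Fin m | k ≤ (i : ℕ) ∧ (interA H S ∩ (H i).carrier).Nonempty ∧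
        interA H S ∩ (H i).carrier ≠ interA H S}, (H i).carrier

/-- The set `ℬ_k` of pairs `(ℬ, Δ)` with `ℬ ⊆ 𝒜_k` an affine NBC subset of `𝒜`
and `Δ` a region of `𝒜_kᶜ/ℬ`. -/
def BFam {n m : ℕ} (H : Fin m → Hyp n) (k : ℕ) :
    Set (Finset (Fin m) × Set (Fin n → ℝ)) :=
  {p | p.1 ⊆ Ak m k ∧ IsAffNBC H p.1 ∧ IsRegionIn (restCompl H k p.1) p.2}

/-- The union of the connected components of `U` meeting `Δ`; when `Δ` is a nonempty
connected subset of `U` this is the unique region of `U` containing `Δ`. -/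
def compIn {n : ℕ} (U Δ : Set (Fin n → ℝ)) : Set (Fin n → ℝ) :=
  ⋃ x ∈ Δ, connectedComponentIn U x

open scoped Classical in
/-- The map `φ_k` (with `e = H_k`): for `(ℬ, Δ) ∈ ℬ_{k−1}`, letting `Δ′` be the unique
region of `𝒜_kᶜ/ℬ` containing `Δ`,
`φ_k(ℬ, Δ) = (ℬ ∪ {H_k}, Δ′ ∩ H_k)` if `Δ ⊆ H_k⁺` and `Δ ≠ Δ′`,
`φ_k(ℬ, Δ) = (ℬ, Δ)` if `Δ ⊆ H_k⁺` and `Δ = Δ′`, and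
`φ_k(ℬ, Δ) = (ℬ, Δ′)` if `Δ ⊆ H_k⁻`. -/
noncomputable def phi {n m : ℕ} (H : Fin m → Hyp n) (k : ℕ) (e : Fin m)
    (p : Finset (Fin m) × Set (Fin n → ℝ)) : Finset (Fin m) × Set (Fin n → ℝ) :=
  if p.2 ⊆ (H e).pos ∧ p.2 ≠ compIn (restCompl H k p.1) p.2 then
    (insert e p.1, compIn (restCompl H k p.1) p.2 ∩ (H e).carrier)
  else if p.2 ⊆ (H e).pos ∧ p.2 = compIn (restCompl H k p.1) p.2 then p
  else if p.2 ⊆ (H e).neg then (p.1, compIn (restCompl H k p.1) p.2)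
  else p

/-- The linear functional `x ↦ ⟨a, x⟩` of a hyperplane. -/
def Hyp.form {n : ℕ} (H : Hyp n) : (Fin n → ℝ) →ₗ[ℝ] ℝ := ∑ i, H.a i • LinearMap.proj i

theorem Hyp.form_apply {n : ℕ} (H : Hyp n) (x : Fin n → ℝ) :
    H.form x = ∑ i, H.a i * x i := by
  simp [Hyp.form]

theorem Hyp.mem_carrier {n : ℕ} (H : Hyp n) (x : Fin n → ℝ) :
    x ∈ H.carrier ↔ H.form x = H.b := by
  rw [H.form_apply]; rfl

theorem Hyp.mem_pos {n : ℕ} (H : Hyp n) (x : Fin n → ℝ) : x ∈ H.pos ↔ H.b < H.form x := by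
  rw [H.form_apply]; rfl

theorem Hyp.mem_neg {n : ℕ} (H : Hyp n) (x : Fin n → ℝ) : x ∈ H.neg ↔ H.form x < H.b := by
  rw [H.form_apply]; rfl

theorem Hyp.continuous_form {n : ℕ} (H : Hyp n) : Continuous H.form :=
  H.form.continuous_of_finiteDimensional

theorem Hyp.isOpen_pos {n : ℕ} (H : Hyp n) : IsOpen H.pos := by
  have : H.pos = {x | H.b < H.form x} := by ext x; exact H.mem_pos x
  rw [this]
  exact isOpen_lt continuous_const H.continuous_form

theorem Hyp.isOpen_neg {n : ℕ} (H : Hyp n) : IsOpen H.neg := by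
  have : H.neg = {x | H.form x < H.b} := by ext x; exact H.mem_neg x
  rw [this]
  exact isOpen_lt H.continuous_form continuous_const

theorem Hyp.convex_pos {n : ℕ} (H : Hyp n) : Convex ℝ H.pos := by
  have : H.pos = {x | H.b < H.form x} := by ext x; exact H.mem_pos x
  rw [this]
  exact convex_halfSpace_gt H.form.isLinear _

theorem Hyp.convex_neg {n : ℕ} (H : Hyp n) : Convex ℝ H.neg := by
  have : H.neg = {x | H.form x < H.b} := by ext x; exact H.mem_neg x
  rw [this]
  exact convex_halfSpace_lt H.form.isLinear _

theorem Hyp.convex_carrier {n : ℕ} (H : Hyp n) : Convex ℝ H.carrier := by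
  have : H.carrier = {x | H.form x = H.b} := by ext x; exact H.mem_carrier x
  rw [this]
  exact convex_hyperplane H.form.isLinear _

theorem Hyp.disjoint_pos_neg {n : ℕ} (H : Hyp n) : Disjoint H.pos H.neg := by
  rw [Set.disjoint_left]
  intro x hx hx'
  rw [H.mem_pos] at hx
  rw [H.mem_neg] at hx'
  exact lt_asymm hx hx'

theorem Hyp.mem_neg_of_notMem {n : ℕ} (H : Hyp n) {x : Fin n → ℝ} (h : x ∉ H.carrier)
    (h' : x ∉ H.pos) : x ∈ H.neg := by
  rw [H.mem_carrier] at h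
  rw [H.mem_pos] at h'
  rw [H.mem_neg]
  exact lt_of_le_of_ne (not_lt.mp h') h

theorem Hyp.finrank_ker_form {n : ℕ} (H : Hyp n) :
    n ≤ Module.finrank ℝ (LinearMap.ker H.form) + 1 := by
  have h := LinearMap.finrank_range_add_finrank_ker H.form
  have h' := Submodule.finrank_le (LinearMap.range H.form)
  simp only [Module.finrank_fin_fun, Module.finrank_self] at h h'
  omega

section Dimension

variable {n m : ℕ} (H : Fin m → Hyp n)

theorem mem_interA {S : Finset (Fin m)} {x : Fin n → ℝ} :
    x ∈ interA H S ↔ ∀ i ∈ S, x ∈ (H i).carrier := by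
  simp [interA]

theorem interA_anti {S T : Finset (Fin m)} (h : S ⊆ T) : interA H T ⊆ interA H S :=
  fun _ hx => (mem_interA H).2 fun i hi => (mem_interA H).1 hx i (h hi)

theorem interA_insert (e : Fin m) (S : Finset (Fin m)) :
    interA H (insert e S) = (H e).carrier ∩ interA H S := by
  ext x
  simp [mem_interA]

theorem convex_interA (S : Finset (Fin m)) : Convex ℝ (interA H S) :=
  convex_iInter₂ fun i _ => (H i).convex_carrier

/-- The direction of a nonempty intersection `⋂S`. -/
def dirA (S : Finset (Fin m)) : Submodule ℝ (Fin n → ℝ) :=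
  ⨅ i ∈ S, LinearMap.ker (H i).form

theorem mem_dirA {S : Finset (Fin m)} {v : Fin n → ℝ} :
    v ∈ dirA H S ↔ ∀ i ∈ S, (H i).form v = 0 := by
  simp [dirA]

theorem sub_mem_dirA_iff {S : Finset (Fin m)} {x y : Fin n → ℝ} (hx : x ∈ interA H S) :
    y - x ∈ dirA H S ↔ y ∈ interA H S := by
  rw [mem_dirA, mem_interA]
  refine forall₂_congr fun i hi => ?_
  have h := ((H i).mem_carrier x).1 ((mem_interA H).1 hx i hi)
  rw [(H i).mem_carrier, map_sub, h, sub_eq_zero]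

theorem adim_interA {S : Finset (Fin m)} (h : (interA H S).Nonempty) :
    adim (interA H S) = Module.finrank ℝ (dirA H S) := by
  obtain ⟨x, hx⟩ := h
  have : interA H S = (AffineSubspace.mk' x (dirA H S) : Set (Fin n → ℝ)) := by
    ext y
    rw [SetLike.mem_coe, AffineSubspace.mem_mk', vsub_eq_sub, sub_mem_dirA_iff H hx]
  rw [adim, this, ← AffineSubspace.direction_eq_vectorSpan, AffineSubspace.direction_mk']

theorem dirA_insert (e : Fin m) (S : Finset (Fin m)) :
    dirA H (insert e S) = LinearMap.ker (H e).form ⊓ dirA H S := by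
  ext v
  simp [mem_dirA]

theorem finrank_dirA_le (e : Fin m) (S : Finset (Fin m)) :
    Module.finrank ℝ (dirA H S) ≤ Module.finrank ℝ (dirA H (insert e S)) + 1 := by
  rw [dirA_insert]
  have h₁ := Submodule.finrank_sup_add_finrank_inf_eq (LinearMap.ker (H e).form) (dirA H S)
  have h₂ := (H e).finrank_ker_form
  have h₃ := Submodule.finrank_le (LinearMap.ker (H e).form ⊔ dirA H S)
  rw [Module.finrank_fin_fun] at h₃
  omega

theorem finrank_dirA_empty : Module.finrank ℝ (dirA H ∅) = n := by
  have : dirA H ∅ = ⊤ := by simp [dirA]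
  rw [this, finrank_top, Module.finrank_fin_fun]

theorem le_finrank_dirA_add_card (S : Finset (Fin m)) :
    n ≤ Module.finrank ℝ (dirA H S) + S.card := by
  induction S using Finset.induction_on with
  | empty => simp [finrank_dirA_empty]
  | insert e S he ih =>
    have := finrank_dirA_le H e S
    rw [Finset.card_insert_of_notMem he]
    omega

theorem exists_isAffCircuit_subset {S : Finset (Fin m)} (hS : (interA H S).Nonempty)
    (h : n + 1 ≤ Module.finrank ℝ (dirA H S) + S.card) :
    ∃ T ⊆ S, T.Nonempty ∧ IsAffCircuit H T := by
  obtain ⟨T, hTS, hT⟩ := exists_minimal_le_of_wellFoundedLT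
    (fun T : Finset (Fin m) => n + 1 ≤ Module.finrank ℝ (dirA H T) + T.card) S h
  have hne : T.Nonempty := by
    rw [Finset.nonempty_iff_ne_empty]
    rintro rfl
    have := hT.prop
    simp [finrank_dirA_empty] at this
  have hint : ∀ R ⊆ T, (interA H R).Nonempty := fun R hR =>
    hS.mono (interA_anti H (hR.trans hTS))
  have hlt : ∀ R ⊂ T, Module.finrank ℝ (dirA H R) + R.card < n + 1 := fun R hR =>
    not_le.1 (hT.not_prop_of_lt hR)
  refine ⟨T, hTS, hne, ⟨hint T subset_rfl, ?_⟩, fun R hR hC => ?_⟩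
  · rw [adim_interA H (hint T subset_rfl)]
    refine le_antisymm ?_ hT.prop
    obtain ⟨j, hj⟩ := hne
    have h₁ := hlt _ (Finset.erase_ssubset hj)
    have h₂ : Module.finrank ℝ (dirA H T) ≤ Module.finrank ℝ (dirA H (T.erase j)) := by
      apply Submodule.finrank_mono
      intro v hv
      exact (mem_dirA H).2 fun i hi => (mem_dirA H).1 hv i (Finset.mem_of_mem_erase hi)
    have h₃ := Finset.card_erase_add_one hj
    omega
  · have h₁ := hC.2
    rw [adim_interA H hC.1] at h₁
    exact (hlt R hR).ne h₁

theorem IsAffCircuit.interA_erase_subset {H : Fin m → Hyp n} {T : Finset (Fin m)}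
    (hT : IsAffCircuit H T) {j : Fin m} (hj : j ∈ T) :
    interA H (T.erase j) ⊆ (H j).carrier := by
  obtain ⟨x, hx⟩ := hT.1.1
  have hx' := interA_anti H (Finset.erase_subset j T) hx
  have h₁ := hT.1.2
  have h₂ := hT.2 _ (Finset.erase_ssubset hj)
  rw [CircuitProp, adim_interA H ⟨x, hx'⟩] at h₂
  rw [adim_interA H ⟨x, hx⟩] at h₁
  have h₃ := finrank_dirA_le H j (T.erase j)
  rw [Finset.insert_erase hj] at h₃
  have h₄ := Finset.card_erase_add_one hj
  have h₅ : dirA H T ≤ dirA H (T.erase j) := fun v hv =>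
    (mem_dirA H).2 fun i hi => (mem_dirA H).1 hv i (Finset.mem_of_mem_erase hi)
  have h₆ := Submodule.finrank_mono h₅
  have h₇ : dirA H T = dirA H (T.erase j) := by
    apply Submodule.eq_of_le_of_finrank_eq h₅
    have : Module.finrank ℝ (dirA H (T.erase j)) + (T.erase j).card ≠ n + 1 :=
      fun h => h₂ ⟨⟨x, hx'⟩, h⟩
    omega
  intro y hy
  rw [← sub_mem_dirA_iff H hx', ← h₇, sub_mem_dirA_iff H hx] at hy
  exact (mem_interA H).1 hy j hj

theorem IsAffNBC.not_subset_carrier {H : Fin m → Hyp n} {S : Finset (Fin m)}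
    (hS : IsAffNBC H S) {j : Fin m} (hj : ∀ i ∈ S, i < j) : ¬ interA H S ⊆ (H j).carrier := by
  intro hsub
  have hjS : j ∉ S := fun h => lt_irrefl _ (hj j h)
  have hint : interA H (insert j S) = interA H S := by
    rw [interA_insert, Set.inter_eq_right.2 hsub]
  have hne : (interA H (insert j S)).Nonempty := hint ▸ hS.1
  have hdim : n + 1 ≤ Module.finrank ℝ (dirA H (insert j S)) + (insert j S).card := by
    rw [← adim_interA H hne, hint, adim_interA H hS.1, Finset.card_insert_of_notMem hjS]
    have := le_finrank_dirA_add_card H S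
    omega
  obtain ⟨T, hTS, hT, hC⟩ := exists_isAffCircuit_subset H hne hdim
  refine hS.2 T hC hT fun i hi => ?_
  rw [Finset.mem_erase] at hi
  refine (Finset.mem_insert.1 (hTS hi.2)).resolve_left ?_
  rintro rfl
  have h₁ := T.le_max' i hi.2
  rcases Finset.mem_insert.1 (hTS (T.max'_mem hT)) with h | h
  · exact hi.1 h.symm
  · exact absurd (hj _ h) (not_lt.2 h₁)

theorem IsAffNBC.subset {H : Fin m → Hyp n} {S T : Finset (Fin m)} (hT : IsAffNBC H T)
    (h : S ⊆ T) : IsAffNBC H S :=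
  ⟨hT.1.mono (interA_anti H h), fun R hR hne hsub => hT.2 R hR hne (hsub.trans h)⟩

theorem isAffNBC_empty : IsAffNBC H ∅ := by
  refine ⟨⟨0, by simp [mem_interA]⟩, fun T hT hne hsub => ?_⟩
  obtain ⟨j, hj⟩ : ∃ j, T = {j} := by
    refine ⟨T.max' hne, ?_⟩
    have h := Finset.insert_erase (T.max'_mem hne)
    rw [Finset.subset_empty.1 hsub] at h
    exact h.symm
  subst hj
  have h := hT.interA_erase_subset (Finset.mem_singleton_self j)
  have huniv : (H j).carrier = Set.univ := by
    refine Set.eq_univ_of_univ_subset fun x _ => h ?_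
    simp [mem_interA]
  have hz : ∀ x, (H j).form x = (H j).b := fun x =>
    ((H j).mem_carrier x).1 (huniv ▸ Set.mem_univ x)
  apply (H j).ha
  funext i
  have h₀ := hz 0
  have h₁ := hz (Pi.single i 1)
  rw [map_zero] at h₀
  rw [← h₀, (H j).form_apply] at h₁
  simpa [Pi.single_apply] using h₁

end Dimension

section Regions

variable {n m : ℕ} (H : Fin m → Hyp n)

/-- The part of `W` lying on none of the hyperplanes indexed by `J`. -/
def offHyp (W : Set (Fin n → ℝ)) (J : Finset (Fin m)) : Set (Fin n → ℝ) :=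
  {x | x ∈ W ∧ ∀ j ∈ J, x ∉ (H j).carrier}

open scoped Classical in
/-- The indices in `J` of the hyperplanes having `x` on their positive side. -/
noncomputable def posSet (J : Finset (Fin m)) (x : Fin n → ℝ) : Finset (Fin m) :=
  J.filter fun j => x ∈ (H j).pos

theorem mem_posSet {J : Finset (Fin m)} {x : Fin n → ℝ} {j : Fin m} :
    j ∈ posSet H J x ↔ j ∈ J ∧ x ∈ (H j).pos := by
  simp [posSet]

theorem posSet_eq_iff {J : Finset (Fin m)} {x y : Fin n → ℝ} :
    posSet H J x = posSet H J y ↔ ∀ j ∈ J, (x ∈ (H j).pos ↔ y ∈ (H j).pos) := by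
  simp [Finset.ext_iff, mem_posSet]

theorem convex_offHyp_posSet {W : Set (Fin n → ℝ)} (hW : Convex ℝ W) (J : Finset (Fin m))
    (σ : Finset (Fin m)) : Convex ℝ {y | y ∈ offHyp H W J ∧ posSet H J y = σ} := by
  intro x hx y hy a b ha hb hab
  have hs := (posSet_eq_iff H).1 (hx.2.trans hy.2.symm)
  have key : ∀ j ∈ J, (a • x + b • y) ∉ (H j).carrier ∧
      (a • x + b • y ∈ (H j).pos ↔ x ∈ (H j).pos) := by
    intro j hj
    by_cases h : x ∈ (H j).pos
    · have := (H j).convex_pos h ((hs j hj).1 h) ha hb hab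
      refine ⟨fun hc => ?_, by simp [h, this]⟩
      rw [(H j).mem_carrier] at hc
      rw [(H j).mem_pos, hc] at this
      exact lt_irrefl _ this
    · have h' : y ∉ (H j).pos := fun h' => h ((hs j hj).2 h')
      have := (H j).convex_neg ((H j).mem_neg_of_notMem (hx.1.2 j hj) h)
        ((H j).mem_neg_of_notMem (hy.1.2 j hj) h') ha hb hab
      refine ⟨fun hc => ?_, ?_⟩
      · rw [(H j).mem_carrier] at hc
        rw [(H j).mem_neg, hc] at this
        exact lt_irrefl _ this
      · simp only [h, iff_false]
        exact Set.disjoint_right.1 (H j).disjoint_pos_neg this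
  refine ⟨⟨hW hx.1.1 hy.1.1 ha hb hab, fun j hj => (key j hj).1⟩, ?_⟩
  rw [← hx.2, posSet_eq_iff]
  exact fun j hj => (key j hj).2

theorem connectedComponentIn_offHyp {W : Set (Fin n → ℝ)} (hW : Convex ℝ W)
    (J : Finset (Fin m)) {x : Fin n → ℝ} (hx : x ∈ offHyp H W J) :
    connectedComponentIn (offHyp H W J) x =
      {y | y ∈ offHyp H W J ∧ posSet H J y = posSet H J x} := by
  apply Set.Subset.antisymm
  · intro y hy
    have hsub := connectedComponentIn_subset (offHyp H W J) x
    refine ⟨hsub hy, (posSet_eq_iff H).2 fun j hj => ?_⟩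
    have hxC := mem_connectedComponentIn hx
    have hcov : connectedComponentIn (offHyp H W J) x ⊆ (H j).pos ∪ (H j).neg := fun z hz => by
      by_cases h : z ∈ (H j).pos
      · exact Or.inl h
      · exact Or.inr ((H j).mem_neg_of_notMem ((hsub hz).2 j hj) h)
    have hpre : IsPreconnected (connectedComponentIn (offHyp H W J) x) :=
      isPreconnected_connectedComponentIn
    constructor <;> intro h
    · exact hpre.subset_left_of_subset_union (H j).isOpen_pos (H j).isOpen_neg
        (H j).disjoint_pos_neg hcov ⟨y, hy, h⟩ hxC
    · exact hpre.subset_left_of_subset_union (H j).isOpen_pos (H j).isOpen_neg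
        (H j).disjoint_pos_neg hcov ⟨x, hxC, h⟩ hy
  · exact (convex_offHyp_posSet H hW J _).isPreconnected.subset_connectedComponentIn
      ⟨hx, rfl⟩ fun _ hy => hy.1

/-- Regions are in bijection with realizable sign vectors. -/
theorem ncard_regionIn_offHyp {W : Set (Fin n → ℝ)} (hW : Convex ℝ W) (J : Finset (Fin m)) :
    {Δ | IsRegionIn (offHyp H W J) Δ}.ncard = (posSet H J '' offHyp H W J).ncard := by
  have h : {Δ | IsRegionIn (offHyp H W J) Δ} =
      (fun σ => {y | y ∈ offHyp H W J ∧ posSet H J y = σ}) '' (posSet H J '' offHyp H W J) := by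
    ext Δ
    rw [Set.image_image]
    constructor
    · rintro ⟨x, hx, rfl⟩
      exact ⟨x, hx, (connectedComponentIn_offHyp H hW J hx).symm⟩
    · rintro ⟨x, hx, rfl⟩
      exact ⟨x, hx, (connectedComponentIn_offHyp H hW J hx).symm⟩
  rw [h]
  apply Set.InjOn.ncard_image
  rintro _ ⟨x, hx, rfl⟩ τ - h
  have : x ∈ {y | y ∈ offHyp H W J ∧ posSet H J y = τ} := by
    rw [← show _ = {y | y ∈ offHyp H W J ∧ posSet H J y = τ} from h]
    exact ⟨hx, rfl⟩
  exact this.2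

/-- Moving slightly off a point of a hyperplane inside `⋂S` does not change the other signs. -/
theorem eventually_mem_offHyp {S J : Finset (Fin m)} {x y : Fin n → ℝ}
    (hx : x ∈ offHyp H (interA H S) J) (hy : y ∈ interA H S) :
    ∀ᶠ t : ℝ in nhds 0, x + t • (y - x) ∈ offHyp H (interA H S) J ∧
      posSet H J (x + t • (y - x)) = posSet H J x := by
  have hc : Filter.Tendsto (fun t : ℝ => x + t • (y - x)) (nhds 0) (nhds x) := by
    have : Continuous fun t : ℝ => x + t • (y - x) := by fun_prop
    simpa using this.tendsto 0
  have key : ∀ j ∈ J, ∀ᶠ t : ℝ in nhds 0, x + t • (y - x) ∉ (H j).carrier ∧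
      (x + t • (y - x) ∈ (H j).pos ↔ x ∈ (H j).pos) := by
    intro j hj
    by_cases h : x ∈ (H j).pos
    · filter_upwards [hc ((H j).isOpen_pos.mem_nhds h)] with t ht
      rw [Set.mem_preimage] at ht
      refine ⟨fun hcar => ?_, by simp [h, ht]⟩
      rw [(H j).mem_carrier] at hcar
      rw [(H j).mem_pos, hcar] at ht
      exact lt_irrefl _ ht
    · filter_upwards [hc ((H j).isOpen_neg.mem_nhds
        ((H j).mem_neg_of_notMem (hx.2 j hj) h))] with t ht
      rw [Set.mem_preimage] at ht
      refine ⟨fun hcar => ?_, ?_⟩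
      · rw [(H j).mem_carrier] at hcar
        rw [(H j).mem_neg, hcar] at ht
        exact lt_irrefl _ ht
      · simp only [h, iff_false]
        exact Set.disjoint_right.1 (H j).disjoint_pos_neg ht
  filter_upwards [(Filter.eventually_all_finset J).2 key] with t ht
  refine ⟨⟨?_, fun j hj => (ht j hj).1⟩, (posSet_eq_iff H).2 fun j hj => (ht j hj).2⟩
  rw [← sub_mem_dirA_iff H hx.1, add_sub_cancel_left]
  exact Submodule.smul_mem _ _ ((sub_mem_dirA_iff H hx.1).2 hy)

theorem exists_pos_and_neg {S J : Finset (Fin m)} {e : Fin m}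
    (he : ¬ interA H S ⊆ (H e).carrier) {x : Fin n → ℝ}
    (hx : x ∈ offHyp H (interA H S) J) (hxe : x ∈ (H e).carrier) :
    (∃ z ∈ offHyp H (interA H S) J, z ∈ (H e).pos ∧ posSet H J z = posSet H J x) ∧
    (∃ z ∈ offHyp H (interA H S) J, z ∈ (H e).neg ∧ posSet H J z = posSet H J x) := by
  obtain ⟨y, hy, hye⟩ := Set.not_subset.1 he
  obtain ⟨δ, hδ, hball⟩ := Metric.eventually_nhds_iff.1 (eventually_mem_offHyp H hx hy)
  have h₁ := @hball (δ / 2) (by rw [Real.dist_eq, sub_zero, abs_of_pos] <;> linarith)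
  have h₂ := @hball (-(δ / 2)) (by rw [Real.dist_eq, sub_zero, abs_neg, abs_of_pos] <;> linarith)
  rw [(H e).mem_carrier] at hxe hye
  have hform : ∀ t : ℝ, (H e).form (x + t • (y - x)) =
      (H e).b + t * ((H e).form y - (H e).b) := fun t => by
    rw [map_add, map_smul, map_sub, hxe, smul_eq_mul]
  rcases lt_or_gt_of_ne hye with h | h
  · refine ⟨⟨_, h₂.1, ?_, h₂.2⟩, ⟨_, h₁.1, ?_, h₁.2⟩⟩
    · rw [(H e).mem_pos, hform]; nlinarith
    · rw [(H e).mem_neg, hform]; nlinarith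
  · refine ⟨⟨_, h₁.1, ?_, h₁.2⟩, ⟨_, h₂.1, ?_, h₂.2⟩⟩
    · rw [(H e).mem_pos, hform]; nlinarith
    · rw [(H e).mem_neg, hform]; nlinarith

theorem exists_mem_carrier {S J : Finset (Fin m)} {e : Fin m} {x y : Fin n → ℝ}
    (hx : x ∈ offHyp H (interA H S) J) (hy : y ∈ offHyp H (interA H S) J)
    (hxe : x ∈ (H e).pos) (hye : y ∈ (H e).neg) (hxy : posSet H J x = posSet H J y) :
    ∃ z ∈ offHyp H (interA H S) J, z ∈ (H e).carrier ∧ posSet H J z = posSet H J x := by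
  have hpre := (convex_offHyp_posSet H (convex_interA H S) J (posSet H J x)).isPreconnected
  rw [(H e).mem_pos] at hxe
  rw [(H e).mem_neg] at hye
  obtain ⟨z, hz, hze⟩ := hpre.intermediate_value (a := y) (b := x) ⟨hy, hxy.symm⟩ ⟨hx, rfl⟩
    (H e).continuous_form.continuousOn ⟨hye.le, hxe.le⟩
  exact ⟨z, hz.1, ((H e).mem_carrier z).2 hze, hz.2⟩

/-- Deletion-restriction for sign vectors. -/
theorem ncard_posSet_insert {S J : Finset (Fin m)} {e : Fin m} (heJ : e ∉ J)
    (he : ¬ interA H S ⊆ (H e).carrier) :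
    (posSet H (insert e J) '' offHyp H (interA H S) (insert e J)).ncard =
      (posSet H J '' offHyp H (interA H S) J).ncard +
        (posSet H J '' offHyp H (interA H (insert e S)) J).ncard := by
  set U := offHyp H (interA H S) J with hU
  set A := posSet H J '' (U ∩ (H e).pos) with hA
  set B := posSet H J '' (U ∩ (H e).neg) with hB
  have hunion : A ∪ B = posSet H J '' U := by
    apply Set.Subset.antisymm
    · exact Set.union_subset (Set.image_mono Set.inter_subset_left)
        (Set.image_mono Set.inter_subset_left)
    · rintro _ ⟨x, hx, rfl⟩
      by_cases hc : x ∈ (H e).carrier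
      · obtain ⟨⟨z, hz, hze, h⟩, -⟩ := exists_pos_and_neg H he hx hc
        exact Or.inl ⟨z, ⟨hz, hze⟩, h⟩
      · by_cases hp : x ∈ (H e).pos
        · exact Or.inl ⟨x, ⟨hx, hp⟩, rfl⟩
        · exact Or.inr ⟨x, ⟨hx, (H e).mem_neg_of_notMem hc hp⟩, rfl⟩
  have hinter : A ∩ B = posSet H J '' offHyp H (interA H (insert e S)) J := by
    apply Set.Subset.antisymm
    · rintro _ ⟨⟨x, ⟨hx, hxe⟩, rfl⟩, ⟨y, ⟨hy, hye⟩, hxy⟩⟩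
      obtain ⟨z, hz, hze, h⟩ := exists_mem_carrier H hx hy hxe hye hxy.symm
      exact ⟨z, ⟨(interA_insert H e S).symm ▸ ⟨hze, hz.1⟩, hz.2⟩, h⟩
    · rintro _ ⟨x, ⟨hx, hxJ⟩, rfl⟩
      rw [interA_insert] at hx
      obtain ⟨⟨z, hz, hze, h⟩, ⟨w, hw, hwe, h'⟩⟩ :=
        exists_pos_and_neg H he (show x ∈ U from ⟨hx.2, hxJ⟩) hx.1
      exact ⟨⟨z, ⟨hz, hze⟩, h⟩, ⟨w, ⟨hw, hwe⟩, h'⟩⟩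
  have hpos : ∀ x ∈ (H e).pos, posSet H (insert e J) x = insert e (posSet H J x) := by
    intro x hx
    ext j
    simp only [mem_posSet, Finset.mem_insert]
    constructor
    · rintro ⟨rfl | h, h'⟩ <;> tauto
    · rintro (rfl | h) <;> tauto
  have hneg : ∀ x ∈ (H e).neg, posSet H (insert e J) x = posSet H J x := by
    intro x hx
    have := Set.disjoint_right.1 (H e).disjoint_pos_neg hx
    ext j
    simp only [mem_posSet, Finset.mem_insert]
    constructor
    · rintro ⟨rfl | h, h'⟩ <;> tauto
    · tauto
  have hpc : ∀ x ∈ (H e).pos, x ∉ (H e).carrier := fun x hx hc => by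
    rw [(H e).mem_carrier] at hc
    rw [(H e).mem_pos, hc] at hx
    exact lt_irrefl _ hx
  have hnc : ∀ x ∈ (H e).neg, x ∉ (H e).carrier := fun x hx hc => by
    rw [(H e).mem_carrier] at hc
    rw [(H e).mem_neg, hc] at hx
    exact lt_irrefl _ hx
  have hsplit : posSet H (insert e J) '' offHyp H (interA H S) (insert e J) =
      (insert e '' A) ∪ B := by
    apply Set.Subset.antisymm
    · rintro _ ⟨x, ⟨hx, hxJ⟩, rfl⟩
      have hxU : x ∈ U := ⟨hx, fun j hj => hxJ j (Finset.mem_insert_of_mem hj)⟩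
      by_cases hp : x ∈ (H e).pos
      · exact Or.inl ⟨_, ⟨x, ⟨hxU, hp⟩, rfl⟩, (hpos x hp).symm⟩
      · have hn := (H e).mem_neg_of_notMem (hxJ e (Finset.mem_insert_self e J)) hp
        exact Or.inr ⟨x, ⟨hxU, hn⟩, (hneg x hn).symm⟩
    · rintro _ (⟨_, ⟨x, ⟨hx, hp⟩, rfl⟩, rfl⟩ | ⟨x, ⟨hx, hn⟩, rfl⟩)
      · exact ⟨x, ⟨hx.1, Finset.forall_mem_insert _ _ _ |>.2 ⟨hpc x hp, hx.2⟩⟩, hpos x hp⟩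
      · exact ⟨x, ⟨hx.1, Finset.forall_mem_insert _ _ _ |>.2 ⟨hnc x hn, hx.2⟩⟩, hneg x hn⟩
  have hnotMem : ∀ x, e ∉ posSet H J x := fun x h => heJ ((mem_posSet H).1 h).1
  have hdisj : Disjoint (insert e '' A) B := by
    rw [Set.disjoint_left]
    rintro _ ⟨σ, -, rfl⟩ ⟨y, -, hy⟩
    exact hnotMem y (hy ▸ Finset.mem_insert_self e σ)
  have hinjOn : Set.InjOn (insert e : Finset (Fin m) → Finset (Fin m)) A := by
    rintro _ ⟨x, -, rfl⟩ _ ⟨y, -, rfl⟩ h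
    rw [← Finset.erase_insert (hnotMem x), ← Finset.erase_insert (hnotMem y)]
    exact congrArg (fun σ => Finset.erase σ e) h
  rw [hsplit, Set.ncard_union_eq hdisj (Set.toFinite _) (Set.toFinite _),
    hinjOn.ncard_image, ← hunion, ← hinter,
    Set.ncard_union_add_ncard_inter A B (Set.toFinite _) (Set.toFinite _)]

end Regions

section NBC

variable {n m : ℕ} (H : Fin m → Hyp n)

/-- The indices of the hyperplanes outside `𝒜_k`. -/
def tailA (m k : ℕ) : Finset (Fin m) := Finset.univ.filter fun i => k ≤ (i : ℕ)

theorem mem_tailA {k : ℕ} {i : Fin m} : i ∈ tailA m k ↔ k ≤ (i : ℕ) := by simp [tailA]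

theorem mem_Ak {k : ℕ} {i : Fin m} : i ∈ Ak m k ↔ (i : ℕ) < k := by simp [Ak]

theorem Ak_succ (e : Fin m) : Ak m (e + 1) = insert e (Ak m e) := by
  ext i
  simp only [Finset.mem_insert, mem_Ak, Fin.ext_iff]
  omega

theorem tailA_eq_insert (e : Fin m) : tailA m e = insert e (tailA m (e + 1)) := by
  ext i
  simp only [Finset.mem_insert, mem_tailA, Fin.ext_iff]
  omega

theorem restCompl_eq_offHyp {k : ℕ} {S : Finset (Fin m)} (hS : IsAffNBC H S)
    (hk : S ⊆ Ak m k) : restCompl H k S = offHyp H (interA H S) (tailA m k) := by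
  ext x
  simp only [restCompl, offHyp, Set.mem_sdiff, Set.mem_iUnion, Set.mem_ofPred_eq, mem_tailA]
  refine and_congr_right fun hx => ?_
  push Not
  refine forall_congr' fun j => ⟨fun h hj hxj => ?_, fun h hj => h hj.1⟩
  refine h ⟨hj, ⟨x, hx, hxj⟩, fun heq => ?_⟩ hxj
  refine hS.not_subset_carrier (j := j) (fun i hi => ?_) (Set.inter_eq_left.1 heq)
  exact Fin.lt_def.2 (lt_of_lt_of_le (mem_Ak.1 (hk hi)) hj)

theorem offHyp_insert_eq_empty {e : Fin m} {S : Finset (Fin m)} (hS : IsAffNBC H S)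
    (h : ¬ IsAffNBC H (insert e S)) :
    offHyp H (interA H (insert e S)) (tailA m (e + 1)) = ∅ := by
  rw [Set.eq_empty_iff_forall_notMem]
  rintro x ⟨hx, hxJ⟩
  refine h ⟨⟨x, hx⟩, fun T hT hne hsub => ?_⟩
  have heT : e ∈ T.erase (T.max' hne) := by
    by_contra heT
    exact hS.2 T hT hne ((Finset.subset_insert_iff_of_notMem heT).1 hsub)
  rw [Finset.mem_erase] at heT
  have hlt : e < T.max' hne := lt_of_le_of_ne (T.le_max' e heT.2) heT.1
  exact hxJ (T.max' hne) (mem_tailA.2 hlt)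
    (hT.interA_erase_subset (T.max'_mem hne) (interA_anti H hsub hx))

/-- The number of regions of `𝒜_kᶜ/S`, counted by sign vectors. -/
noncomputable def signCount (k : ℕ) (S : Finset (Fin m)) : ℕ :=
  (posSet H (tailA m k) '' offHyp H (interA H S) (tailA m k)).ncard

open scoped Classical in
theorem signCount_step {e : Fin m} {S : Finset (Fin m)} (hS : IsAffNBC H S)
    (hk : S ⊆ Ak m e) :
    signCount H e S = signCount H (e + 1) S +
      if IsAffNBC H (insert e S) then signCount H (e + 1) (insert e S) else 0 := by
  rw [signCount, tailA_eq_insert, ncard_posSet_insert H (by simp [mem_tailA])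
    (hS.not_subset_carrier fun i hi => mem_Ak.1 (hk hi))]
  split_ifs with h
  · rfl
  · rw [offHyp_insert_eq_empty H hS h]
    simp [signCount]

open scoped Classical in
theorem sum_signCount_step (e : Fin m) :
    ∑ S ∈ (Ak m e).powerset, (if IsAffNBC H S then signCount H e S else 0) =
      ∑ S ∈ (Ak m (e + 1)).powerset, (if IsAffNBC H S then signCount H (e + 1) S else 0) := by
  rw [Ak_succ, Finset.sum_powerset_insert (by simp [mem_Ak]), ← Finset.sum_add_distrib]
  refine Finset.sum_congr rfl fun S hS => ?_
  by_cases h : IsAffNBC H S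
  · simp only [h, if_true]
    exact signCount_step H h (Finset.mem_powerset.1 hS)
  · have h' : ¬ IsAffNBC H (insert e S) := fun h' => h (h'.subset (Finset.subset_insert e S))
    simp [h, h']

open scoped Classical in
theorem sum_signCount (k : ℕ) (hk : k ≤ m) :
    signCount H 0 ∅ =
      ∑ S ∈ (Ak m k).powerset, (if IsAffNBC H S then signCount H k S else 0) := by
  induction k with
  | zero =>
    have : Ak m 0 = ∅ := by ext i; simp [mem_Ak]
    simp [this, isAffNBC_empty]
  | succ k ih => exact (ih (by omega)).trans (sum_signCount_step H ⟨k, hk⟩)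

theorem signCount_top {S : Finset (Fin m)} (hS : IsAffNBC H S) : signCount H m S = 1 := by
  have h : tailA m m = ∅ := by
    ext i
    simp [mem_tailA]
  have hp : posSet H ∅ = fun _ => (∅ : Finset (Fin m)) := by
    funext x
    simp [posSet]
  obtain ⟨x, hx⟩ := hS.1
  have hne : (offHyp H (interA H S) ∅).Nonempty := ⟨x, hx, by simp⟩
  rw [signCount, h, hp, hne.image_const, Set.ncard_singleton]

theorem ncard_regionIn_restCompl {k : ℕ} {S : Finset (Fin m)} (hS : IsAffNBC H S)
    (hk : S ⊆ Ak m k) : {Δ | IsRegionIn (restCompl H k S) Δ}.ncard = signCount H k S := by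
  rw [restCompl_eq_offHyp H hS hk, ncard_regionIn_offHyp H (convex_interA H S), signCount]

theorem ncard_regions : (regions H).ncard = signCount H 0 ∅ := by
  rw [signCount, ← ncard_regionIn_offHyp H (convex_interA H ∅), regions]
  congr! 4
  ext x
  simp [offHyp, mem_interA, mem_tailA]

end NBC

open scoped Classical in
/-- **Theorem (Fu–Wang).** For each `k = 0, 1, …, m`, the number of regions of `𝒜`
equals the sum, over all affine NBC subsets `ℬ ⊆ 𝒜_k`, of the number of regions of
`𝒜_kᶜ/ℬ`, and this common value also equals the number of affine NBC subsets of `𝒜`. -/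
theorem stmt_15 (n m : ℕ) (H : Fin m → Hyp n)
    (hinj : Function.Injective fun i => (H i).carrier)
    (k : ℕ) (hk : k ≤ m) :
    (regions H).ncard =
      ∑ S ∈ Finset.univ.filter
          (fun S : Finset (Fin m) => IsAffNBC H S ∧ S ⊆ Ak m k),
        {Δ | IsRegionIn (restCompl H k S) Δ}.ncard ∧
    (regions H).ncard = {S : Finset (Fin m) | IsAffNBC H S}.ncard := by
  have hfilter : ∀ k, Finset.univ.filter
      (fun S : Finset (Fin m) => IsAffNBC H S ∧ S ⊆ Ak m k) =
        (Ak m k).powerset.filter (IsAffNBC H) := fun k => by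
    ext S
    simp [and_comm]
  constructor
  · rw [ncard_regions, sum_signCount H k hk, hfilter, ← Finset.sum_filter]
    refine Finset.sum_congr rfl fun S hS => ?_
    rw [Finset.mem_filter, Finset.mem_powerset] at hS
    exact (ncard_regionIn_restCompl H hS.2 hS.1).symm
  · have hAk : Ak m m = Finset.univ := by
      ext i
      simp [mem_Ak]
    rw [ncard_regions, sum_signCount H m le_rfl, ← Finset.sum_filter, hAk,
      Finset.sum_congr rfl fun S hS => signCount_top H (Finset.mem_filter.1 hS).2,
      Finset.sum_const, smul_eq_mul, mul_one, ← Set.ncard_coe_finset]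
    congr 1
    ext S
    simp
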